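/- Let q be a prime power, r > 1, and u a divisor of (q^r−1)/(q−1). For polynomials f, g ∈ F_{q^r}[X,Y], f(P) = g(P) for every point P ∈ NT_u if and only if f − g lies in the ideal of F_{q^r}[X,Y] generated by X^u − Tr_{F_{q^r}/F_q}(Y) and X^{u(q−1)+1} − X. -/

import Mathlib

open scoped BigOperators
open MvPolynomial

/-- The extended Norm--Trace curve `x^u = Tr_{F_{q^r}/F_q}(y) = ∑_{i<r} y^{q^i}`. -/
def ntCurve (K : Type*) [Field K] (q r u : ℕ) : Set (K × K) :=
  {P | P.1 ^ u = ∑ i ∈ Finset.range r, P.2 ^ q ^ i}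

lemma nt_trace_pow {A : Type*} [CommRing A] (p k r : ℕ) [Fact p.Prime] [CharP A p] (y : A) :
    (∑ i ∈ Finset.range r, y ^ (p ^ k) ^ i) ^ (p ^ k)
      = (∑ i ∈ Finset.range r, y ^ (p ^ k) ^ i) + (y ^ (p ^ k) ^ r - y) := by
  rw [sum_pow_char_pow]
  have h1 := Finset.sum_range_succ (fun i => y ^ (p ^ k) ^ i) r
  have h2 := Finset.sum_range_succ' (fun i => y ^ (p ^ k) ^ i) r
  have h3 : ∀ i, (y ^ (p ^ k) ^ i) ^ (p ^ k) = y ^ (p ^ k) ^ (i + 1) := by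
    intro i
    rw [← pow_mul, ← pow_succ]
  simp only [h3]
  rw [h1] at h2
  simp only [pow_zero, pow_one] at h2
  linear_combination -h2

lemma nt_prod_eq {K : Type*} [Field K] [Fintype K] (i : Fin 2) :
    ∏ s : K, ((X i : MvPolynomial (Fin 2) K) - C s) = X i ^ Fintype.card K - X i := by
  have hn := FiniteField.X_pow_card_sub_X_natDegree_eq K (Fintype.one_lt_card (α := K))
  have hr := FiniteField.roots_X_pow_card_sub_X K
  have h := Polynomial.prod_multiset_X_sub_C_of_monic_of_roots_card_eq
    (p := (Polynomial.X ^ Fintype.card K - Polynomial.X : Polynomial K))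
    (Polynomial.monic_X_pow_sub (by
      rw [Polynomial.degree_X]; exact_mod_cast Fintype.one_lt_card (α := K)))
    (by rw [hr, hn]; rfl)
  rw [hr] at h
  have h' : ∏ s : K, (Polynomial.X - Polynomial.C s)
    = (Polynomial.X ^ Fintype.card K - Polynomial.X : Polynomial K) := h
  have := congrArg (Polynomial.aeval (X i : MvPolynomial (Fin 2) K)) h'
  simpa [map_prod, MvPolynomial.algebraMap_eq] using this

lemma nt_pow_of_pow {A : Type*} [CommRing A] (x : A) (m n : ℕ) (h : x ^ (m + 1) = x) :
    x ^ (m * n + 1) = x := by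
  induction n with
  | zero => simp
  | succ n ih =>
    have : m * (n + 1) + 1 = (m * n + 1) + m := by ring
    rw [this, pow_add, ih, ← pow_succ', h]

theorem eval_eq_iff_sub_mem_ideal (q r u : ℕ) (hq : IsPrimePow q) (hr : 1 < r)
    (hu : 0 < u) (hdvd : u ∣ (q ^ r - 1) / (q - 1))
    (K : Type*) [Field K] [Fintype K] (hK : Fintype.card K = q ^ r)
    (f g : MvPolynomial (Fin 2) K) :
    (∀ P ∈ ntCurve K q r u, eval ![P.1, P.2] f = eval ![P.1, P.2] g)
      ↔ f - g ∈ Ideal.span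
          {(X 0 : MvPolynomial (Fin 2) K) ^ u - ∑ i ∈ Finset.range r, X 1 ^ q ^ i,
           (X 0 : MvPolynomial (Fin 2) K) ^ (u * (q - 1) + 1) - X 0} := by
  have hq1 : 1 < q := hq.one_lt
  have hQ : 0 < q ^ r := by positivity
  obtain ⟨c, hc⟩ : u * (q - 1) ∣ q ^ r - 1 := by
    have h1 : q - 1 ∣ q ^ r - 1 := by simpa using Nat.sub_dvd_pow_sub_pow q 1 r
    have := Nat.mul_dvd_mul_right hdvd (q - 1)
    rwa [Nat.div_mul_cancel h1] at this
  have hcQ : u * (q - 1) * c + 1 = q ^ r := by omega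
  obtain ⟨p, k, hp, hk, hpk⟩ := hq
  have : Fact p.Prime := ⟨hp.nat_prime⟩
  have : CharP K p := charP_of_card_eq_prime_pow (f := k * r) (by rw [hK, ← hpk, pow_mul])
  have tr : ∀ {A : Type _} [CommRing A] [CharP A p] (y : A),
    (∑ i ∈ Finset.range r, y ^ q ^ i) ^ q
      = (∑ i ∈ Finset.range r, y ^ q ^ i) + (y ^ q ^ r - y) := by
    intro A _ _ y
    have := nt_trace_pow p k r y
    rwa [hpk] at this
  set s : MvPolynomial (Fin 2) K := X 0 ^ u - ∑ i ∈ Finset.range r, X 1 ^ q ^ i with hs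
  set t : MvPolynomial (Fin 2) K := X 0 ^ (u * (q - 1) + 1) - X 0 with ht
  set I := Ideal.span {s, t} with hI
  have hsI : s ∈ I := Ideal.subset_span (by simp)
  have htI : t ∈ I := Ideal.subset_span (by simp)
  constructor
  · intro h
    have hx1 : (Ideal.Quotient.mk I (X 0)) ^ (u * (q - 1) + 1) = Ideal.Quotient.mk I (X 0) := by
      rw [← map_pow, Ideal.Quotient.eq]; exact htI
    have hx2 : (Ideal.Quotient.mk I (X 0)) ^ u
        = Ideal.Quotient.mk I (∑ i ∈ Finset.range r, X 1 ^ q ^ i) := by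
      rw [← map_pow, Ideal.Quotient.eq]; exact hsI
    have hX : (X 0 : MvPolynomial (Fin 2) K) ^ q ^ r - X 0 ∈ I := by
      rw [← Ideal.Quotient.eq, map_pow, ← hcQ]
      exact nt_pow_of_pow _ _ _ hx1
    have hY : (X 1 : MvPolynomial (Fin 2) K) ^ q ^ r - X 1 ∈ I := by
      have h1 := congrArg (Ideal.Quotient.mk I) (tr (X 1 : MvPolynomial (Fin 2) K))
      rw [map_pow, map_add, ← hx2] at h1
      have h2 : ((Ideal.Quotient.mk I (X 0)) ^ u) ^ q = (Ideal.Quotient.mk I (X 0)) ^ u := by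
        rw [← pow_mul]
        have e : u * q = (u * (q - 1) + 1) + (u - 1) := by
          obtain ⟨v, rfl⟩ : ∃ v, q = v + 1 := ⟨q - 1, by omega⟩
          rw [Nat.add_sub_cancel, Nat.mul_succ]; omega
        rw [e, pow_add, hx1, ← pow_succ']
        congr 1; omega
      rw [h2] at h1
      exact Ideal.Quotient.eq_zero_iff_mem.mp (by simpa using h1)
    have key : (f - g) * (1 - s ^ (q ^ r - 1)) ∈ I := by
      obtain ⟨w, -, hw⟩ := combinatorial_nullstellensatz_exists_linearCombination
        (fun _ : Fin 2 => (Finset.univ : Finset K)) (fun _ => Finset.univ_nonempty)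
        ((f - g) * (1 - s ^ (q ^ r - 1))) (by
          intro z _
          have hz : z = ![z 0, z 1] := by
            ext i; fin_cases i <;> rfl
          by_cases h0 : eval z s = 0
          · have := h (z 0, z 1) (by
              simp only [ntCurve, Set.mem_ofPred_eq]
              rw [hs] at h0
              simpa [sub_eq_zero] using h0)
            simp only at this
            rw [← hz] at this
            simp [this]
          · have h1 := FiniteField.pow_card_sub_one_eq_one _ h0
            rw [hK] at h1
            simp [h1])
      rw [hw, Finsupp.linearCombination_apply]
      refine Ideal.sum_mem _ fun i _ => ?_
      simp only [smul_eq_mul]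
      refine Ideal.mul_mem_left _ _ ?_
      simp only [nt_prod_eq, hK]
      fin_cases i
      · exact hX
      · exact hY
    have h3 : (f - g) * s ^ (q ^ r - 1) ∈ I := by
      refine Ideal.mul_mem_left _ _ (Ideal.pow_mem_of_mem _ hsI _ ?_)
      have : 1 < q ^ r := Nat.one_lt_pow (by omega) hq1
      omega
    have := Ideal.add_mem _ key h3
    convert this using 1
    ring
  · intro h P hP
    simp only [ntCurve, Set.mem_ofPred_eq] at hP
    have hle : I ≤ RingHom.ker (eval ![P.1, P.2] : MvPolynomial (Fin 2) K →+* K) := by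
      rw [hI, Ideal.span_le]
      rintro a (rfl | rfl)
      · simp [RingHom.mem_ker, hs, hP]
      · have h1 := tr P.2
        rw [← hK, FiniteField.pow_card, sub_self, add_zero, ← hP] at h1
        simp only [SetLike.mem_coe, RingHom.mem_ker, ht, map_sub, map_pow, eval_X,
          Matrix.cons_val_zero]
        by_cases h0 : P.1 = 0
        · simp [h0]
        · have h2 : P.1 ^ (u * (q - 1)) = 1 := by
            rw [pow_mul]
            apply mul_right_cancel₀ (pow_ne_zero u h0)
            rw [← pow_succ, one_mul, Nat.sub_add_cancel hq1.le, h1]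
          rw [pow_succ, h2]; ring
    have := hle h
    rwa [RingHom.mem_ker, map_sub, sub_eq_zero] at this
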